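/- (Lemma A.2.) Under hypotheses (i)–(iv) of the inexact anchored iteration, setting ρ_j = 2·sp(Q^0 − Q^*) + (2/3)·ε·j, for all 1 ≤ k ≤ n one has sp(Q^k − Q^{k−1}) ≤ (2/(k(k+1)))·∑_{i=1}^{k} ρ_{i+2}. -/

import Mathlib

open Finset

/-- Span seminorm: `sp x = max x − min x` on a nonempty finite index set. -/
noncomputable def sp {J : Type*} [Fintype J] [Nonempty J] (x : J → ℝ) : ℝ :=
  (univ.sup' univ_nonempty x) - (univ.inf' univ_nonempty x)

/-- Sup norm `‖x‖_∞ = max_j |x j|` on a nonempty finite index set. -/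
noncomputable def supNorm {J : Type*} [Fintype J] [Nonempty J] (x : J → ℝ) : ℝ :=
  univ.sup' univ_nonempty (fun j => |x j|)

/-- `P` is a transition kernel: nonnegative entries, each row sums to one. -/
def IsKernel {S A : Type*} [Fintype S] (P : S → A → S → ℝ) : Prop :=
  (∀ s a s', 0 ≤ P s a s') ∧ (∀ s a, ∑ s', P s a s' = 1)

/-- The Bellman operator `𝒯(Q)(s,a) = r(s,a) + ∑_{s'} P(s'|s,a)·max_{a'} Q(s',a')`. -/
noncomputable def bellman {S A : Type*} [Fintype S] [Fintype A] [Nonempty A]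
    (P : S → A → S → ℝ) (r : S → A → ℝ) (Q : S × A → ℝ) : S × A → ℝ :=
  fun p => r p.1 p.2 + ∑ s', P p.1 p.2 s' * (univ.sup' univ_nonempty (fun a' => Q (s', a')))

/-- The anchoring coefficients `β_k = k/(k+2)`. -/
noncomputable def beta (k : ℕ) : ℝ := (k : ℝ) / ((k : ℝ) + 2)

theorem sub_le_sp {J : Type*} [Fintype J] [Nonempty J] (x : J → ℝ) (i j : J) :
    x i - x j ≤ sp x :=
  sub_le_sub (le_sup' x (mem_univ i)) (inf'_le x (mem_univ j))

theorem sp_le {J : Type*} [Fintype J] [Nonempty J] {x : J → ℝ} {c : ℝ}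
    (h : ∀ i j, x i - x j ≤ c) : sp x ≤ c := by
  obtain ⟨i, -, hi⟩ := exists_mem_eq_sup' univ_nonempty x
  obtain ⟨j, -, hj⟩ := exists_mem_eq_inf' univ_nonempty x
  rw [sp, hi, hj]
  exact h i j

theorem sp_nonneg {J : Type*} [Fintype J] [Nonempty J] (x : J → ℝ) : 0 ≤ sp x := by
  obtain ⟨i⟩ := ‹Nonempty J›
  simpa using sub_le_sp x i i

theorem abs_le_supNorm {J : Type*} [Fintype J] [Nonempty J] (x : J → ℝ) (i : J) :
    |x i| ≤ supNorm x :=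
  le_sup' (fun j => |x j|) (mem_univ i)

section Bellman

variable {S A : Type*} [Fintype S] [Fintype A] [Nonempty A]
  {P : S → A → S → ℝ} {r : S → A → ℝ}

theorem bellman_le_add (hP : IsKernel P) {Q Q' : S × A → ℝ} {M : ℝ}
    (h : ∀ p, Q p ≤ Q' p + M) (p : S × A) : bellman P r Q p ≤ bellman P r Q' p + M := by
  have hmax : ∀ s, univ.sup' univ_nonempty (fun a => Q (s, a)) ≤
      univ.sup' univ_nonempty (fun a => Q' (s, a)) + M := fun s =>
    sup'_le _ _ fun a _ => (h (s, a)).trans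
      (add_le_add_left (le_sup' (fun a => Q' (s, a)) (mem_univ a)) M)
  have hsum := sum_le_sum fun s (_ : s ∈ univ) =>
    mul_le_mul_of_nonneg_left (hmax s) (hP.1 p.1 p.2 s)
  simp only [mul_add, sum_add_distrib, ← sum_mul, hP.2, one_mul] at hsum
  simp only [bellman]
  linarith

/-- The Bellman operator is nonexpansive in the span seminorm. -/
theorem sp_bellman_sub_le [Nonempty S] (hP : IsKernel P) (Q Q' : S × A → ℝ) :
    sp (fun p => bellman P r Q p - bellman P r Q' p) ≤ sp (fun p => Q p - Q' p) := by
  refine sp_le fun p q => ?_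
  have hp := bellman_le_add (r := r) hP (Q := Q) (Q' := Q')
    (M := univ.sup' univ_nonempty fun p => Q p - Q' p)
    (fun p => by linarith [le_sup' (fun p => Q p - Q' p) (mem_univ p)]) p
  have hq := bellman_le_add (r := r) hP (Q := Q') (Q' := Q)
    (M := -univ.inf' univ_nonempty fun p => Q p - Q' p)
    (fun p => by linarith [inf'_le (fun p => Q p - Q' p) (mem_univ p)]) q
  simp only [sp]
  linarith

/-- An `ε`-approximate Bellman update expands the span distance to a solution of the optimality
equation by at most `2 * ε`. -/
theorem sp_sub_le_of_approx_bellman [Nonempty S] (hP : IsKernel P) {Q T Qstar : S × A → ℝ}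
    {ε gstar : ℝ} (hT : supNorm (fun p => T p - bellman P r Q p) ≤ ε)
    (hstar : bellman P r Qstar = fun p => Qstar p + gstar) :
    sp (fun p => T p - Qstar p) ≤ sp (fun p => Q p - Qstar p) + 2 * ε := by
  refine sp_le fun p q => ?_
  have hB := (sub_le_sp _ p q).trans (sp_bellman_sub_le (r := r) hP Q Qstar)
  have hp := (abs_le.1 ((abs_le_supNorm _ p).trans hT)).2
  have hq := (abs_le.1 ((abs_le_supNorm _ q).trans hT)).1
  simp only [hstar] at hB
  linarith

theorem sp_iterate_sub_le [Nonempty S] (hP : IsKernel P) {ε : ℝ} {n : ℕ}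
    {Q T : ℕ → S × A → ℝ} {Qstar : S × A → ℝ} {gstar : ℝ}
    (h1 : ∀ k, 1 ≤ k → k ≤ n →
      Q k = fun p => (1 - beta k) * Q 0 p + beta k * T (k - 1) p)
    (h2 : ∀ k, k ≤ n → supNorm (fun p => T k p - bellman P r (Q k) p) ≤ ε)
    (h3 : bellman P r Qstar = fun p => Qstar p + gstar) :
    ∀ k, k ≤ n → sp (fun p => Q k p - Qstar p) ≤
      sp (fun p => Q 0 p - Qstar p) + 2 / 3 * ε * k := by
  intro k
  induction k with
  | zero => simp
  | succ k ih =>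
    intro hk
    have hT := sp_sub_le_of_approx_bellman hP (h2 k (by lia)) h3
    have hQ := ih (by lia)
    refine sp_le fun p q => ?_
    rw [h1 (k + 1) (by lia) hk]
    have hβ : beta (k + 1) * ((k : ℝ) + 3) = k + 1 := by
      simp only [beta]; push_cast; field_simp; ring
    have hβ0 : 0 ≤ beta (k + 1) := by unfold beta; positivity
    have hβ1 : 0 ≤ 1 - beta (k + 1) := by
      simp only [beta, sub_nonneg]
      exact div_le_one_of_le₀ (by linarith) (by positivity)
    have hTpq := mul_le_mul_of_nonneg_left (((sub_le_sp _ p q).trans hT).trans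
      (add_le_add_left hQ _)) hβ0
    have hQpq := mul_le_mul_of_nonneg_left
      (sub_le_sp (fun p => Q 0 p - Qstar p) p q) hβ1
    simp only [Nat.add_sub_cancel]
    push_cast
    linear_combination hTpq + hQpq + 2 / 3 * ε * hβ

theorem sp_update_sub_anchor_le [Nonempty S] (hP : IsKernel P) {ε : ℝ} {n : ℕ}
    {Q T : ℕ → S × A → ℝ} {Qstar : S × A → ℝ} {gstar : ℝ}
    (h1 : ∀ k, 1 ≤ k → k ≤ n →
      Q k = fun p => (1 - beta k) * Q 0 p + beta k * T (k - 1) p)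
    (h2 : ∀ k, k ≤ n → supNorm (fun p => T k p - bellman P r (Q k) p) ≤ ε)
    (h3 : bellman P r Qstar = fun p => Qstar p + gstar) (k : ℕ) (hk : k ≤ n) :
    sp (fun p => T k p - Q 0 p) ≤
      2 * sp (fun p => Q 0 p - Qstar p) + 2 / 3 * ε * (k + 3) := by
  have hT := sp_sub_le_of_approx_bellman hP (h2 k hk) h3
  have hQ := sp_iterate_sub_le hP h1 h2 h3 k hk
  refine sp_le fun p q => ?_
  have hTpq := sub_le_sp (fun p => T k p - Qstar p) p q
  have hQqp := sub_le_sp (fun p => Q 0 p - Qstar p) q p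
  linarith

end Bellman

/-- Lemma A.2: under the inexact anchored iteration hypotheses (i)–(iv), with
`ρ_j = 2·sp(Q^0 − Q^*) + (2/3)·ε·j`, one has
`sp(Q^k − Q^{k−1}) ≤ (2/(k(k+1)))·∑_{i=1}^{k} ρ_{i+2}` for all `1 ≤ k ≤ n`. -/
theorem savia_lemma_A2

    {S A : Type*} [Fintype S] [Nonempty S] [Fintype A] [Nonempty A]
    (P : S → A → S → ℝ) (hP : IsKernel P) (r : S → A → ℝ)
    (ε : ℝ) (hε : 0 ≤ ε) (n : ℕ)
    (Q T : ℕ → S × A → ℝ) (Qstar : S × A → ℝ) (gstar : ℝ)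
    (h1 : ∀ k, 1 ≤ k → k ≤ n →
      Q k = fun p => (1 - beta k) * Q 0 p + beta k * T (k - 1) p)
    (h2 : ∀ k, k ≤ n → supNorm (fun p => T k p - bellman P r (Q k) p) ≤ ε)
    (h3 : bellman P r Qstar = fun p => Qstar p + gstar)
    (h4 : ∀ k, 1 ≤ k → k ≤ n →
      sp (fun p => T k p - T (k - 1) p) ≤ sp (fun p => Q k p - Q (k - 1) p))
    :
    ∀ k, 1 ≤ k → k ≤ n → sp (fun p => Q k p - Q (k - 1) p)
      ≤ (2 / ((k : ℝ) * ((k : ℝ) + 1))) *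
        ∑ i ∈ Finset.Icc 1 k,
          (2 * sp (fun p => Q 0 p - Qstar p) + (2 / 3) * ε * ((i : ℝ) + 2)) := by
  intro k hk
  induction k, hk using Nat.le_induction with
  | base =>
    intro hn
    have hT := sp_update_sub_anchor_le hP h1 h2 h3 0 (by lia)
    refine sp_le fun p q => ?_
    have hpq := sub_le_sp (fun p => T 0 p - Q 0 p) p q
    have hnonneg := sp_nonneg (fun p => Q 0 p - Qstar p)
    rw [h1 1 le_rfl hn]
    simp only [beta, Icc_self, sum_singleton, Nat.sub_self, Nat.cast_one, Nat.cast_zero] at *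
    linarith
  | succ k hk ih =>
    intro hn
    have hT := sp_update_sub_anchor_le hP h1 h2 h3 k (by lia)
    have hdiff := h4 k hk (by lia)
    have hprev := ih (by lia)
    have hD := sp_nonneg (fun p => Q 0 p - Qstar p)
    rw [sum_Icc_succ_top (by lia)]
    set R := ∑ i ∈ Icc 1 k, (2 * sp (fun p => Q 0 p - Qstar p) + 2 / 3 * ε * ((i : ℝ) + 2))
    set D := sp (fun p => Q 0 p - Qstar p)
    have hk0 : (0 : ℝ) < k := by exact_mod_cast hk
    refine sp_le fun p q => ?_
    have hanchor := (sub_le_sp (fun p => T k p - Q 0 p) p q).trans hT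
    have hupdate := ((sub_le_sp (fun p => T k p - T (k - 1) p) p q).trans hdiff).trans hprev
    have hρ : 0 ≤ 2 * D + 2 / 3 * ε * ((k : ℝ) + 3) := by positivity
    rw [h1 (k + 1) (by lia) hn, Nat.add_sub_cancel, h1 k hk (by lia)]
    have hβ0 : 0 ≤ beta k := by unfold beta; positivity
    have hβ : beta (k + 1) - beta k = 2 / (((k : ℝ) + 2) * (k + 3)) := by
      simp only [beta]; push_cast; field_simp; ring
    have hβ' : beta k * (2 / ((k : ℝ) * (k + 1))) = 2 / (((k : ℝ) + 1) * (k + 2)) := by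
      simp only [beta]; field_simp
    have hβ_sub : 0 ≤ beta (k + 1) - beta k := by rw [hβ]; positivity
    have hβ_le : beta (k + 1) - beta k ≤ 2 / (((k : ℝ) + 1) * (k + 2)) := by
      rw [hβ]
      gcongr 2 / ?_
      nlinarith
    have ha := (mul_le_mul_of_nonneg_left hanchor hβ_sub).trans
      (mul_le_mul_of_nonneg_right hβ_le hρ)
    have hu := mul_le_mul_of_nonneg_left hupdate hβ0
    rw [← mul_assoc, hβ'] at hu
    have hcast : (k : ℝ) + 1 + 1 = k + 2 := by ring
    beta_reduce
    push_cast
    rw [hcast]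
    linear_combination ha + hu
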